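/- Let κ, ℓ > 0 be real, n ∈ ℕ, let f : ℍ → ℂ be smooth with Δ_κ f = 0, and let g : ℍ → ℂ be holomorphic. Then, pointwise on ℍ, (L_κ f)·(R_ℓⁿ g) = (−4π)^n·(Γ(n+1)·Γ(κ)/Γ(κ+n))·L_{κ+ℓ+2n}([f,g]_n). -/

import Mathlib

noncomputable section

/-- The partial derivative `∂_u` in the real direction `1`. -/
def du (f : ℂ → ℂ) (z : ℂ) : ℂ := fderiv ℝ f z 1

/-- The partial derivative `∂_v` in the imaginary direction `i`. -/
def dv (f : ℂ → ℂ) (z : ℂ) : ℂ := fderiv ℝ f z Complex.I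

/-- The Wirtinger derivative `∂_τ = (1/2)(∂_u − i∂_v)`. -/
def dtau (f : ℂ → ℂ) (z : ℂ) : ℂ := (1 / 2) * (du f z - Complex.I * dv f z)

/-- The Wirtinger derivative `∂_τ̄ = (1/2)(∂_u + i∂_v)`. -/
def dtaubar (f : ℂ → ℂ) (z : ℂ) : ℂ := (1 / 2) * (du f z + Complex.I * dv f z)

/-- The Maass lowering operator `L_κ = −2iv²·∂_τ̄`. -/
def lowerOp (κ : ℝ) (f : ℂ → ℂ) : ℂ → ℂ :=
  fun z => -2 * Complex.I * (z.im ^ 2 : ℝ) * dtaubar f z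

/-- The Maass raising operator `R_κ = 2i∂_τ + κ/v`. -/
def raiseOp (κ : ℝ) (f : ℂ → ℂ) : ℂ → ℂ :=
  fun z => 2 * Complex.I * dtau f z + ((κ / z.im : ℝ) : ℂ) * f z

/-- The iterated raising operator `R_κⁿ = R_{κ+2n−2} ∘ ⋯ ∘ R_{κ+2} ∘ R_κ`. -/
def raiseIter (κ : ℝ) : ℕ → (ℂ → ℂ) → (ℂ → ℂ)
  | 0, f => f
  | n + 1, f => raiseOp (κ + 2 * n) (raiseIter κ n f)

/-- The iterated Wirtinger derivative `∂_τ^r`. -/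
def dtauIter : ℕ → (ℂ → ℂ) → (ℂ → ℂ)
  | 0, f => f
  | r + 1, f => dtau (dtauIter r f)

/-- The `n`-th Rankin–Cohen bracket. -/
def rcBracket (κ ℓ : ℝ) (n : ℕ) (f g : ℂ → ℂ) : ℂ → ℂ := fun z =>
  (2 * (Real.pi : ℂ) * Complex.I) ^ (-(n : ℤ)) *
    ∑ r ∈ Finset.range (n + 1),
      (((-1 : ℝ) ^ r * (Real.Gamma (κ + n) * Real.Gamma (ℓ + n)) /
          (Real.Gamma ((n - r : ℕ) + 1) * Real.Gamma (κ + n - ((n - r : ℕ) : ℝ)) *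
            Real.Gamma (r + 1) * Real.Gamma (ℓ + n - r)) : ℝ) : ℂ) *
        dtauIter r f z * dtauIter (n - r) g z

/-- The weight-`κ` hyperbolic Laplace operator `Δ_κ`. -/
def laplaceOp (κ : ℝ) (f : ℂ → ℂ) (z : ℂ) : ℂ :=
  -(z.im ^ 2 : ℝ) * (du (du f) z + dv (dv f) z) +
    Complex.I * (κ : ℂ) * (z.im : ℝ) * (du f z + Complex.I * dv f z)

/-- The open upper half plane, as a subset of `ℂ`. -/
def upperHalf : Set ℂ := {z : ℂ | 0 < z.im}

/-- The function `1 / v`, with values in `ℂ`. -/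
def invIm (z : ℂ) : ℂ := ((z.im : ℝ) : ℂ)⁻¹

lemma isOpen_upperHalf : IsOpen upperHalf :=
  isOpen_lt continuous_const Complex.continuous_im

section Wirtinger

variable {f g : ℂ → ℂ} {z : ℂ}

lemma fderiv_eq_of_eqOn {U : Set ℂ} (hU : IsOpen U) (h : Set.EqOn f g U) (hz : z ∈ U) :
    fderiv ℝ f z = fderiv ℝ g z :=
  (h.eventuallyEq_of_mem (hU.mem_nhds hz)).fderiv_eq

lemma dtau_eq_of_eqOn {U : Set ℂ} (hU : IsOpen U) (h : Set.EqOn f g U) (hz : z ∈ U) :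
    dtau f z = dtau g z := by
  simp only [dtau, du, dv, fderiv_eq_of_eqOn hU h hz]

lemma dtau_mul (hf : DifferentiableAt ℝ f z) (hg : DifferentiableAt ℝ g z) :
    dtau (fun w => f w * g w) z = dtau f z * g z + f z * dtau g z := by
  simp only [dtau, du, dv, fderiv_fun_mul hf hg, add_apply,
    smul_apply, smul_eq_mul]
  ring

lemma dtaubar_mul (hf : DifferentiableAt ℝ f z) (hg : DifferentiableAt ℝ g z) :
    dtaubar (fun w => f w * g w) z = dtaubar f z * g z + f z * dtaubar g z := by
  simp only [dtaubar, du, dv, fderiv_fun_mul hf hg, add_apply,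
    smul_apply, smul_eq_mul]
  ring

lemma dtau_const_mul (c : ℂ) (hf : DifferentiableAt ℝ f z) :
    dtau (fun w => c * f w) z = c * dtau f z := by
  simp only [dtau, du, dv, fderiv_const_mul hf, smul_apply, smul_eq_mul]
  ring

lemma dtaubar_const_mul (c : ℂ) (hf : DifferentiableAt ℝ f z) :
    dtaubar (fun w => c * f w) z = c * dtaubar f z := by
  simp only [dtaubar, du, dv, fderiv_const_mul hf, smul_apply, smul_eq_mul]
  ring

lemma dtau_sum {ι : Type*} (s : Finset ι) {F : ι → ℂ → ℂ}
    (hF : ∀ i ∈ s, DifferentiableAt ℝ (F i) z) :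
    dtau (fun w => ∑ i ∈ s, F i w) z = ∑ i ∈ s, dtau (F i) z := by
  simp only [dtau, du, dv, fderiv_fun_sum hF, sum_apply,
    Finset.mul_sum, ← Finset.sum_sub_distrib]

lemma dtaubar_sum {ι : Type*} (s : Finset ι) {F : ι → ℂ → ℂ}
    (hF : ∀ i ∈ s, DifferentiableAt ℝ (F i) z) :
    dtaubar (fun w => ∑ i ∈ s, F i w) z = ∑ i ∈ s, dtaubar (F i) z := by
  simp only [dtaubar, du, dv, fderiv_fun_sum hF, sum_apply,
    Finset.mul_sum, ← Finset.sum_add_distrib]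

lemma fderiv_real_apply_of_differentiableAt (hf : DifferentiableAt ℂ f z) (w : ℂ) :
    fderiv ℝ f z w = w * deriv f z := by
  rw [hf.fderiv_restrictScalars ℝ]
  simp

lemma dtau_eq_deriv (hf : DifferentiableAt ℂ f z) : dtau f z = deriv f z := by
  simp only [dtau, du, dv, fderiv_real_apply_of_differentiableAt hf]
  linear_combination (-(1 / 2) * deriv f z) * Complex.I_mul_I

lemma dtaubar_eq_zero (hf : DifferentiableAt ℂ f z) : dtaubar f z = 0 := by
  simp only [dtaubar, du, dv, fderiv_real_apply_of_differentiableAt hf]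
  linear_combination ((1 / 2) * deriv f z) * Complex.I_mul_I

end Wirtinger

section Smooth

variable {f : ℂ → ℂ} {U : Set ℂ} {z : ℂ}

lemma ContDiffOn.fderiv_apply_const (hf : ContDiffOn ℝ (⊤ : ℕ∞) f U) (hU : IsOpen U) (w : ℂ) :
    ContDiffOn ℝ (⊤ : ℕ∞) (fun z => fderiv ℝ f z w) U :=
  (hf.fderiv_of_isOpen hU (m := (⊤ : ℕ∞)) le_rfl).clm_apply contDiffOn_const

lemma ContDiffOn.contDiffOn_dtau (hf : ContDiffOn ℝ (⊤ : ℕ∞) f U) (hU : IsOpen U) :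
    ContDiffOn ℝ (⊤ : ℕ∞) (dtau f) U :=
  contDiffOn_const.mul ((hf.fderiv_apply_const hU 1).sub
    (contDiffOn_const.mul (hf.fderiv_apply_const hU Complex.I)))

lemma ContDiffOn.contDiffOn_dtaubar (hf : ContDiffOn ℝ (⊤ : ℕ∞) f U) (hU : IsOpen U) :
    ContDiffOn ℝ (⊤ : ℕ∞) (dtaubar f) U :=
  contDiffOn_const.mul ((hf.fderiv_apply_const hU 1).add
    (contDiffOn_const.mul (hf.fderiv_apply_const hU Complex.I)))

lemma ContDiffOn.contDiffOn_dtauIter (hf : ContDiffOn ℝ (⊤ : ℕ∞) f U) (hU : IsOpen U) (r : ℕ) :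
    ContDiffOn ℝ (⊤ : ℕ∞) (dtauIter r f) U := by
  induction r with
  | zero => exact hf
  | succ r ih => exact ih.contDiffOn_dtau hU

lemma ContDiffOn.differentiableAt_of_isOpen (hf : ContDiffOn ℝ (⊤ : ℕ∞) f U) (hU : IsOpen U)
    (hz : z ∈ U) : DifferentiableAt ℝ f z :=
  (hf.contDiffAt (hU.mem_nhds hz)).differentiableAt (by simp)

lemma fderiv_fderiv_apply (hf : ContDiffOn ℝ (⊤ : ℕ∞) f U) (hU : IsOpen U) (hz : z ∈ U)
    (a b : ℂ) :
    fderiv ℝ (fun w => fderiv ℝ f w a) z b = fderiv ℝ (fderiv ℝ f) z b a := by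
  have h : DifferentiableAt ℝ (fderiv ℝ f) z :=
    ((hf.fderiv_of_isOpen hU (m := (⊤ : ℕ∞)) le_rfl).contDiffAt
      (hU.mem_nhds hz)).differentiableAt (by simp)
  rw [fderiv_clm_apply h (differentiableAt_const a)]
  simp

lemma dv_du_eq_du_dv (hf : ContDiffOn ℝ (⊤ : ℕ∞) f U) (hU : IsOpen U) (hz : z ∈ U) :
    dv (du f) z = du (dv f) z := by
  have h : IsSymmSndFDerivAt ℝ f z :=
    (hf.contDiffAt (hU.mem_nhds hz)).isSymmSndFDerivAt
      (by simpa using WithTop.coe_le_coe.mpr (le_top : (2 : ℕ∞) ≤ ⊤))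
  change fderiv ℝ (fun w => fderiv ℝ f w 1) z Complex.I =
    fderiv ℝ (fun w => fderiv ℝ f w Complex.I) z 1
  rw [fderiv_fderiv_apply hf hU hz, fderiv_fderiv_apply hf hU hz]
  exact h _ _

lemma fderiv_dtau (hf : ContDiffOn ℝ (⊤ : ℕ∞) f U) (hU : IsOpen U) (hz : z ∈ U) (w : ℂ) :
    fderiv ℝ (dtau f) z w =
      (1 / 2) * (fderiv ℝ (du f) z w - Complex.I * fderiv ℝ (dv f) z w) := by
  have h1 : DifferentiableAt ℝ (du f) z :=
    (hf.fderiv_apply_const hU 1).differentiableAt_of_isOpen hU hz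
  have h2 : DifferentiableAt ℝ (dv f) z :=
    (hf.fderiv_apply_const hU Complex.I).differentiableAt_of_isOpen hU hz
  change fderiv ℝ (fun x => (1 / 2) * (du f x - Complex.I * dv f x)) z w = _
  rw [fderiv_const_mul (h1.fun_sub (h2.const_mul _)), fderiv_fun_sub h1 (h2.const_mul _),
    fderiv_const_mul h2]
  simp

lemma fderiv_dtaubar (hf : ContDiffOn ℝ (⊤ : ℕ∞) f U) (hU : IsOpen U) (hz : z ∈ U) (w : ℂ) :
    fderiv ℝ (dtaubar f) z w =
      (1 / 2) * (fderiv ℝ (du f) z w + Complex.I * fderiv ℝ (dv f) z w) := by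
  have h1 : DifferentiableAt ℝ (du f) z :=
    (hf.fderiv_apply_const hU 1).differentiableAt_of_isOpen hU hz
  have h2 : DifferentiableAt ℝ (dv f) z :=
    (hf.fderiv_apply_const hU Complex.I).differentiableAt_of_isOpen hU hz
  change fderiv ℝ (fun x => (1 / 2) * (du f x + Complex.I * dv f x)) z w = _
  rw [fderiv_const_mul (h1.fun_add (h2.const_mul _)), fderiv_fun_add h1 (h2.const_mul _),
    fderiv_const_mul h2]
  simp [mul_add]

lemma dtau_dtaubar_eq (hf : ContDiffOn ℝ (⊤ : ℕ∞) f U) (hU : IsOpen U) (hz : z ∈ U) :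
    dtau (dtaubar f) z = (1 / 4) * (du (du f) z + dv (dv f) z) := by
  have h := dv_du_eq_du_dv hf hU hz
  simp only [dtau, du, dv, fderiv_dtaubar hf hU hz] at h ⊢
  linear_combination (-(1 / 4) * Complex.I) * h -
    (1 / 4) * fderiv ℝ (dv f) z Complex.I * Complex.I_mul_I

lemma dtaubar_dtau_eq (hf : ContDiffOn ℝ (⊤ : ℕ∞) f U) (hU : IsOpen U) (hz : z ∈ U) :
    dtaubar (dtau f) z = (1 / 4) * (du (du f) z + dv (dv f) z) := by
  have h := dv_du_eq_du_dv hf hU hz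
  simp only [dtaubar, du, dv, fderiv_dtau hf hU hz] at h ⊢
  linear_combination ((1 / 4) * Complex.I) * h -
    (1 / 4) * fderiv ℝ (dv f) z Complex.I * Complex.I_mul_I

lemma dtaubar_dtauIter (hf : ContDiffOn ℝ (⊤ : ℕ∞) f U) (hU : IsOpen U) (r : ℕ) :
    Set.EqOn (dtaubar (dtauIter r f)) (dtauIter r (dtaubar f)) U := by
  induction r with
  | zero => exact fun _ _ => rfl
  | succ r ih =>
    intro z hz
    have hr := hf.contDiffOn_dtauIter hU r
    calc dtaubar (dtau (dtauIter r f)) z = dtau (dtaubar (dtauIter r f)) z := by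
          rw [dtaubar_dtau_eq hr hU hz, dtau_dtaubar_eq hr hU hz]
      _ = dtau (dtauIter r (dtaubar f)) z := dtau_eq_of_eqOn hU ih hz

lemma DifferentiableOn.differentiableOn_dtauIter (hf : DifferentiableOn ℂ f U) (hU : IsOpen U) (r : ℕ) :
    DifferentiableOn ℂ (dtauIter r f) U := by
  induction r with
  | zero => exact hf
  | succ r ih =>
    exact (ih.deriv hU).congr fun z hz => dtau_eq_deriv (ih.differentiableAt (hU.mem_nhds hz))

end Smooth

section InvIm

variable {z : ℂ}

lemma hasFDerivAt_invIm (hz : z ∈ upperHalf) :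
    HasFDerivAt invIm (-(invIm z ^ 2) • (Complex.ofRealCLM ∘L Complex.imCLM)) z := by
  have hz' : (0 : ℝ) < z.im := hz
  have h := Complex.ofRealCLM.hasFDerivAt.comp z
    ((hasDerivAt_inv hz'.ne').comp_hasFDerivAt z Complex.imCLM.hasFDerivAt)
  have hfun : invIm = ⇑Complex.ofRealCLM ∘ (fun y : ℝ => y⁻¹) ∘ Complex.im := by
    funext w
    simp [invIm]
  rw [hfun]
  refine h.congr_fderiv (ContinuousLinearMap.ext fun w => ?_)
  simp

lemma dtau_invIm (hz : z ∈ upperHalf) : dtau invIm z = Complex.I / 2 * invIm z ^ 2 := by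
  simp only [dtau, du, dv, (hasFDerivAt_invIm hz).fderiv]
  simp
  ring

lemma differentiableAt_invIm_pow (hz : z ∈ upperHalf) (r : ℕ) :
    DifferentiableAt ℝ (fun w => invIm w ^ r) z :=
  (hasFDerivAt_invIm hz).differentiableAt.fun_pow r

lemma dtau_invIm_pow (hz : z ∈ upperHalf) (r : ℕ) :
    dtau (fun w => invIm w ^ r) z = Complex.I / 2 * r * invIm z ^ (r + 1) := by
  induction r with
  | zero => simp [dtau, du, dv]
  | succ r ih =>
    simp only [pow_succ _ r]
    rw [dtau_mul (differentiableAt_invIm_pow hz r) (hasFDerivAt_invIm hz).differentiableAt,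
      ih, dtau_invIm hz]
    push_cast
    ring

end InvIm

lemma dtau_dtaubar_of_laplaceOp_eq_zero {κ : ℝ} {f : ℂ → ℂ} {z : ℂ}
    (hf : ContDiffOn ℝ (⊤ : ℕ∞) f upperHalf) (hz : z ∈ upperHalf) (h : laplaceOp κ f z = 0) :
    dtau (dtaubar f) z = Complex.I / 2 * κ * invIm z * dtaubar f z := by
  have hv : ((z.im : ℝ) : ℂ) ≠ 0 := by
    have hz' : (0 : ℝ) < z.im := hz
    exact_mod_cast hz'.ne'
  rw [dtau_dtaubar_eq hf isOpen_upperHalf hz]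
  simp only [laplaceOp, Complex.ofReal_pow] at h
  simp only [dtaubar, invIm]
  field_simp
  refine mul_left_cancel₀ hv ?_
  linear_combination -4 * h

/-- If `Δ_κ f = 0` then `∂_τ^r ∂_τ̄ f = (i/2)^r (κ)_r v^{-r} ∂_τ̄ f`. -/
lemma dtauIter_dtaubar_of_laplaceOp_eq_zero {κ : ℝ} (hκ : 0 < κ) {f : ℂ → ℂ}
    (hf : ContDiffOn ℝ (⊤ : ℕ∞) f upperHalf) (h : ∀ z ∈ upperHalf, laplaceOp κ f z = 0) (r : ℕ) :
    Set.EqOn (dtauIter r (dtaubar f))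
      (fun z => (Complex.I / 2) ^ r * ((Real.Gamma (κ + r) / Real.Gamma κ : ℝ) : ℂ) *
        (invIm z ^ r * dtaubar f z)) upperHalf := by
  induction r with
  | zero => intro z _; simp [dtauIter, (Real.Gamma_pos_of_pos hκ).ne']
  | succ r ih =>
    intro z hz
    have hF : DifferentiableAt ℝ (dtaubar f) z :=
      (hf.contDiffOn_dtaubar isOpen_upperHalf).differentiableAt_of_isOpen isOpen_upperHalf hz
    have hG : Real.Gamma (κ + (r + 1 : ℕ)) = (κ + r) * Real.Gamma (κ + r) := by
      rw [← Real.Gamma_add_one (by positivity)]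
      push_cast
      ring_nf
    change dtau (dtauIter r (dtaubar f)) z = _
    rw [dtau_eq_of_eqOn isOpen_upperHalf ih hz,
      dtau_const_mul _ ((differentiableAt_invIm_pow hz r).fun_mul hF),
      dtau_mul (differentiableAt_invIm_pow hz r) hF, dtau_invIm_pow hz,
      dtau_dtaubar_of_laplaceOp_eq_zero hf hz (h z hz), hG]
    push_cast
    ring

/-- The coefficients `(n choose r) ∏_{j < r} (ℓ + n - 1 - j)` of the iterated raising operator. -/
def raiseCoeff (ℓ : ℝ) (n r : ℕ) : ℝ :=
  n.choose r * ∏ j ∈ Finset.range r, (ℓ + n - 1 - j)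

lemma raiseCoeff_zero_right (ℓ : ℝ) (n : ℕ) : raiseCoeff ℓ n 0 = 1 := by
  simp [raiseCoeff]

lemma raiseCoeff_self_succ (ℓ : ℝ) (n : ℕ) : raiseCoeff ℓ n (n + 1) = 0 := by
  simp [raiseCoeff]

lemma raiseCoeff_succ_succ (ℓ : ℝ) {n r : ℕ} (hr : r ≤ n) :
    raiseCoeff ℓ (n + 1) (r + 1) =
      raiseCoeff ℓ n (r + 1) + (ℓ + 2 * n - r) * raiseCoeff ℓ n r := by
  have hP : ∏ j ∈ Finset.range (r + 1), (ℓ + (n + 1 : ℕ) - 1 - j) =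
      (∏ j ∈ Finset.range r, (ℓ + n - 1 - j)) * (ℓ + n) := by
    rw [Finset.prod_range_succ']
    congr 1
    · refine Finset.prod_congr rfl fun j _ => ?_
      push_cast
      ring
    · push_cast
      ring
  have hC : (n.choose (r + 1) : ℝ) * (r + 1) = n.choose r * (n - r) := by
    have h := Nat.choose_succ_right_eq n r
    rw [← Nat.cast_sub hr]
    exact_mod_cast h
  rw [raiseCoeff, raiseCoeff, raiseCoeff, hP, Finset.prod_range_succ, Nat.choose_succ_succ]
  push_cast
  linear_combination (∏ j ∈ Finset.range r, (ℓ + n - 1 - j)) * hC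

lemma raiseCoeff_eq_Gamma {ℓ : ℝ} (hℓ : 0 < ℓ) {n r : ℕ} (hr : r ≤ n) :
    raiseCoeff ℓ n r = n.choose r * (Real.Gamma (ℓ + n) / Real.Gamma (ℓ + n - r)) := by
  have hpos : ∀ r ≤ n, 0 < ℓ + n - r := fun r hr => by
    have : (r : ℝ) ≤ n := by exact_mod_cast hr
    linarith
  rw [raiseCoeff]
  congr 1
  rw [eq_div_iff (Real.Gamma_pos_of_pos (hpos r hr)).ne']
  induction r with
  | zero => simp
  | succ r ih =>
    have h := hpos (r + 1) hr
    rw [← ih (by lia), Finset.prod_range_succ, mul_assoc]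
    congr 1
    rw [show ℓ + n - r = (ℓ + n - (r + 1 : ℕ)) + 1 by push_cast; ring,
      Real.Gamma_add_one h.ne']
    push_cast
    ring

/-- The expansion of the iterated raising operator on holomorphic functions. -/
lemma raiseIter_eqOn (ℓ : ℝ) {g : ℂ → ℂ} (hg : DifferentiableOn ℂ g upperHalf) (n : ℕ) :
    Set.EqOn (raiseIter ℓ n g)
      (fun z => ∑ r ∈ Finset.range (n + 1), ((raiseCoeff ℓ n r : ℂ) * (2 * Complex.I) ^ (n - r)) *
        (invIm z ^ r * dtauIter (n - r) g z)) upperHalf := by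
  induction n with
  | zero => intro z _; simp [raiseIter, dtauIter, raiseCoeff]
  | succ n ih =>
    intro z hz
    have hD : ∀ r, DifferentiableAt ℝ (dtauIter r g) z := fun r =>
      ((hg.differentiableOn_dtauIter isOpen_upperHalf r).differentiableAt
        (isOpen_upperHalf.mem_nhds hz)).restrictScalars ℝ
    have hterm : ∀ r ∈ Finset.range (n + 1), DifferentiableAt ℝ
        (fun w => ((raiseCoeff ℓ n r : ℂ) * (2 * Complex.I) ^ (n - r)) *
          (invIm w ^ r * dtauIter (n - r) g w)) z := fun r _ =>
      ((differentiableAt_invIm_pow hz r).fun_mul (hD _)).const_mul _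
    have hd : dtau (raiseIter ℓ n g) z = ∑ r ∈ Finset.range (n + 1),
        ((raiseCoeff ℓ n r : ℂ) * (2 * Complex.I) ^ (n - r)) *
          (Complex.I / 2 * r * invIm z ^ (r + 1) * dtauIter (n - r) g z +
            invIm z ^ r * dtauIter (n + 1 - r) g z) := by
      rw [dtau_eq_of_eqOn isOpen_upperHalf ih hz, dtau_sum _ hterm]
      refine Finset.sum_congr rfl fun r hr => ?_
      rw [dtau_const_mul _ ((differentiableAt_invIm_pow hz r).fun_mul (hD _)),
        dtau_mul (differentiableAt_invIm_pow hz r) (hD _), dtau_invIm_pow hz,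
        Nat.succ_sub (Finset.mem_range_succ_iff.mp hr)]
      rfl
    have hshift : ∑ r ∈ Finset.range (n + 1),
        ((raiseCoeff ℓ n r : ℂ) * (2 * Complex.I) ^ (n + 1 - r)) *
          (invIm z ^ r * dtauIter (n + 1 - r) g z) =
        ∑ r ∈ Finset.range (n + 1),
          ((raiseCoeff ℓ n (r + 1) : ℂ) * (2 * Complex.I) ^ (n - r)) *
            (invIm z ^ (r + 1) * dtauIter (n - r) g z) +
          (2 * Complex.I) ^ (n + 1) * dtauIter (n + 1) g z := by
      have h := Finset.sum_range_succ (fun r =>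
        ((raiseCoeff ℓ n r : ℂ) * (2 * Complex.I) ^ (n + 1 - r)) *
          (invIm z ^ r * dtauIter (n + 1 - r) g z)) (n + 1)
      rw [Finset.sum_range_succ'] at h
      simpa [raiseCoeff_self_succ, raiseCoeff_zero_right] using h.symm
    have hcoeff : ((((ℓ + 2 * n) / z.im : ℝ)) : ℂ) = (ℓ + 2 * n) * invIm z := by
      simp [invIm, div_eq_mul_inv]
    change 2 * Complex.I * dtau (raiseIter ℓ n g) z +
      (((ℓ + 2 * n) / z.im : ℝ) : ℂ) * raiseIter ℓ n g z = _
    simp only [Finset.sum_range_succ' _ (n + 1), Nat.add_sub_add_right, raiseCoeff_zero_right,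
      Nat.sub_zero, pow_zero, Complex.ofReal_one, one_mul]
    calc _ = ∑ r ∈ Finset.range (n + 1), (ℓ + 2 * n - r) *
            (((raiseCoeff ℓ n r : ℂ) * (2 * Complex.I) ^ (n - r)) *
              (invIm z ^ (r + 1) * dtauIter (n - r) g z)) +
          ∑ r ∈ Finset.range (n + 1),
            ((raiseCoeff ℓ n r : ℂ) * (2 * Complex.I) ^ (n + 1 - r)) *
              (invIm z ^ r * dtauIter (n + 1 - r) g z) := by
          rw [hd, ih hz, hcoeff, Finset.mul_sum, Finset.mul_sum, ← Finset.sum_add_distrib,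
            ← Finset.sum_add_distrib]
          refine Finset.sum_congr rfl fun r hr => ?_
          rw [Nat.sub_add_comm (Finset.mem_range_succ_iff.mp hr), pow_succ]
          linear_combination (raiseCoeff ℓ n r * (2 * Complex.I) ^ (n - r) * r *
            invIm z ^ (r + 1) * dtauIter (n - r) g z) * Complex.I_mul_I
      _ = _ := by
          rw [hshift, ← add_assoc, ← Finset.sum_add_distrib]
          congr 1
          refine Finset.sum_congr rfl fun r hr => ?_
          rw [raiseCoeff_succ_succ ℓ (Finset.mem_range_succ_iff.mp hr)]
          push_cast
          ring

/-- The coefficients of the Rankin–Cohen bracket in terms of those of the raising operator. -/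
lemma rcBracket_coeff_eq {κ ℓ : ℝ} (hκ : 0 < κ) (hℓ : 0 < ℓ) {n r : ℕ} (hr : r ≤ n) :
    (-1 : ℝ) ^ r * (Real.Gamma (κ + n) * Real.Gamma (ℓ + n)) /
        (Real.Gamma ((n - r : ℕ) + 1) * Real.Gamma (κ + n - ((n - r : ℕ) : ℝ)) *
          Real.Gamma (r + 1) * Real.Gamma (ℓ + n - r)) * (Real.Gamma (κ + r) / Real.Gamma κ) =
      (-1 : ℝ) ^ r * (Real.Gamma (κ + n) / (Real.Gamma (n + 1) * Real.Gamma κ)) *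
        raiseCoeff ℓ n r := by
  have h1 : κ + n - ((n - r : ℕ) : ℝ) = κ + r := by
    rw [Nat.cast_sub hr]
    ring
  have hrn : (r : ℝ) ≤ n := by exact_mod_cast hr
  have h2 := (Real.Gamma_pos_of_pos (show 0 < κ + r by positivity)).ne'
  have h3 := (Real.Gamma_pos_of_pos hκ).ne'
  have h4 := (Real.Gamma_pos_of_pos (show 0 < ℓ + n - r by linarith)).ne'
  rw [h1, raiseCoeff_eq_Gamma hℓ hr, Nat.cast_choose ℝ hr, Real.Gamma_nat_eq_factorial,
    Real.Gamma_nat_eq_factorial, Real.Gamma_nat_eq_factorial]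
  have := n.factorial_ne_zero
  have := r.factorial_ne_zero
  have := (n - r).factorial_ne_zero
  field_simp

/-- `∂_τ̄` of the Rankin–Cohen bracket of `f` with a holomorphic function, when `Δ_κ f = 0`. -/
lemma dtaubar_rcBracket {κ ℓ : ℝ} (hκ : 0 < κ) (hℓ : 0 < ℓ) (n : ℕ) {f g : ℂ → ℂ}
    (hf : ContDiffOn ℝ (⊤ : ℕ∞) f upperHalf) (hΔf : ∀ z ∈ upperHalf, laplaceOp κ f z = 0)
    (hg : DifferentiableOn ℂ g upperHalf) {z : ℂ} (hz : z ∈ upperHalf) :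
    (2 * Complex.I) ^ n * dtaubar (rcBracket κ ℓ n f g) z =
      (2 * (Real.pi : ℂ) * Complex.I) ^ (-(n : ℤ)) *
        ((Real.Gamma (κ + n) / (Real.Gamma (n + 1) * Real.Gamma κ) : ℝ) : ℂ) *
        dtaubar f z * raiseIter ℓ n g z := by
  have hU := isOpen_upperHalf
  have hfr : ∀ r, DifferentiableAt ℝ (dtauIter r f) z := fun r =>
    (hf.contDiffOn_dtauIter hU r).differentiableAt_of_isOpen hU hz
  have hgr : ∀ r, DifferentiableAt ℂ (dtauIter r g) z := fun r =>
    (hg.differentiableOn_dtauIter hU r).differentiableAt (hU.mem_nhds hz)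
  have hterm : ∀ (c : ℂ) (r s : ℕ), DifferentiableAt ℝ
      (fun w => c * dtauIter r f w * dtauIter s g w) z := fun c r s =>
    ((hfr r).const_mul c).fun_mul ((hgr s).restrictScalars ℝ)
  have hbar : ∀ (c : ℂ) (r s : ℕ), dtaubar (fun w => c * dtauIter r f w * dtauIter s g w) z =
      c * dtauIter r (dtaubar f) z * dtauIter s g z := fun c r s => by
    rw [dtaubar_mul ((hfr r).const_mul c) ((hgr s).restrictScalars ℝ), dtaubar_eq_zero (hgr s),
      dtaubar_const_mul c (hfr r), dtaubar_dtauIter hf hU r hz, mul_zero, add_zero]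
  unfold rcBracket
  rw [dtaubar_const_mul _ (DifferentiableAt.fun_sum fun r _ => hterm _ r _),
    dtaubar_sum _ (fun r _ => hterm _ r _), raiseIter_eqOn ℓ hg n hz, mul_left_comm,
    mul_assoc (_ ^ (-(n : ℤ))), mul_assoc (_ ^ (-(n : ℤ)))]
  refine congrArg _ ?_
  simp only [Finset.mul_sum]
  refine Finset.sum_congr rfl fun r hr => ?_
  have hr' := Finset.mem_range_succ_iff.mp hr
  have hc := congrArg (fun x : ℝ => (x : ℂ)) (rcBracket_coeff_eq hκ hℓ hr')
  rw [hbar, dtauIter_dtaubar_of_laplaceOp_eq_zero hκ hf hΔf r hz]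
  have hI : (2 * Complex.I) ^ n * (Complex.I / 2) ^ r * (-1) ^ r = (2 * Complex.I) ^ (n - r) := by
    conv_lhs => rw [← Nat.sub_add_cancel hr', pow_add, mul_assoc, mul_assoc, ← mul_pow, ← mul_pow]
    rw [show 2 * Complex.I * (Complex.I / 2 * -1) = 1 by
      linear_combination -Complex.I_mul_I, one_pow, mul_one]
  simp only [Complex.ofReal_mul _ (Real.Gamma (κ + r) / Real.Gamma κ),
    Complex.ofReal_mul _ (raiseCoeff ℓ n r),
    Complex.ofReal_mul ((-1 : ℝ) ^ r) (_ / (_ * _)), Complex.ofReal_pow, Complex.ofReal_neg,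
    Complex.ofReal_one] at hc
  rw [← hI]
  linear_combination ((2 * Complex.I) ^ n * (Complex.I / 2) ^ r *
    (invIm z ^ r * dtaubar f z) * dtauIter (n - r) g z) * hc

/-- For `κ, ℓ > 0`, `n ∈ ℕ`, smooth `f : ℍ → ℂ` with `Δ_κ f = 0`, and
holomorphic `g : ℍ → ℂ`, pointwise on `ℍ`:
`(L_κ f)·(R_ℓⁿ g) = (−4π)^n (Γ(n+1)Γ(κ)/Γ(κ+n)) L_{κ+ℓ+2n}([f,g]_n)`. -/
theorem stmt11 (κ ℓ : ℝ) (hκ : 0 < κ) (hℓ : 0 < ℓ) (n : ℕ) (f g : ℂ → ℂ)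
    (hf : ContDiffOn ℝ (⊤ : ℕ∞) f {z : ℂ | 0 < z.im})
    (hΔf : ∀ z : ℂ, 0 < z.im → laplaceOp κ f z = 0)
    (hg : DifferentiableOn ℂ g {z : ℂ | 0 < z.im}) :
    ∀ z : ℂ, 0 < z.im →
      lowerOp κ f z * raiseIter ℓ n g z =
        (((-4 * Real.pi : ℝ) ^ n : ℝ) : ℂ) *
          ((Real.Gamma (n + 1) * Real.Gamma κ / Real.Gamma (κ + n) : ℝ) : ℂ) *
          lowerOp (κ + ℓ + 2 * n) (rcBracket κ ℓ n f g) z := by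
  intro z hz
  have hmain := dtaubar_rcBracket hκ hℓ n hf hΔf hg hz
  have hconst : (((-4 * Real.pi : ℝ) ^ n : ℝ) : ℂ) *
      (2 * (Real.pi : ℂ) * Complex.I) ^ (-(n : ℤ)) = (2 * Complex.I) ^ n := by
    have hπ : (Real.pi : ℂ) ≠ 0 := by exact_mod_cast Real.pi_ne_zero
    rw [zpow_neg, zpow_natCast, ← inv_pow, Complex.ofReal_pow, ← mul_pow]
    congr 1
    push_cast
    field_simp
    linear_combination (-4 : ℂ) * Complex.I_mul_I
  have hΓ : ((Real.Gamma (n + 1) * Real.Gamma κ / Real.Gamma (κ + n) : ℝ) : ℂ) *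
      ((Real.Gamma (κ + n) / (Real.Gamma (n + 1) * Real.Gamma κ) : ℝ) : ℂ) = 1 := by
    have h1 := (Real.Gamma_pos_of_pos (show (0 : ℝ) < n + 1 by positivity)).ne'
    have h2 := (Real.Gamma_pos_of_pos hκ).ne'
    have h3 := (Real.Gamma_pos_of_pos (show 0 < κ + n by positivity)).ne'
    rw [← Complex.ofReal_mul, ← Complex.ofReal_one]
    congr 1
    field_simp
  have h2I : (2 * Complex.I) ^ n ≠ 0 := pow_ne_zero _ (by simp)
  refine mul_left_cancel₀ h2I ?_
  simp only [lowerOp]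
  set A := (((-4 * Real.pi : ℝ) ^ n : ℝ) : ℂ)
  set B := ((Real.Gamma (n + 1) * Real.Gamma κ / Real.Gamma (κ + n) : ℝ) : ℂ)
  set C := ((Real.Gamma (κ + n) / (Real.Gamma (n + 1) * Real.Gamma κ) : ℝ) : ℂ)
  set p := (2 * (Real.pi : ℂ) * Complex.I) ^ (-(n : ℤ))
  set K := -2 * Complex.I * ((z.im ^ 2 : ℝ) : ℂ)
  linear_combination (-(A * B * K)) * hmain -
    (K * dtaubar f z * raiseIter ℓ n g z * (B * C)) * hconst -
    ((2 * Complex.I) ^ n * K * dtaubar f z * raiseIter ℓ n g z) * hΓ
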